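/- arXiv:0709.0498 — 2 statements merged into one kernel-verified Lean document; each statement's English description precedes it below -/
import Mathlib

section
/- Fix an integer k ≥ 1. The family of functions φ_{j_1,…,j_k}(x_1,…,x_k) = 2^{k/2} · det( sin(π j_p x_q) )_{1≤p,q≤k}, indexed by integer tuples j_1 > j_2 > … > j_k > 0 and regarded as elements of L²(Ω_k) with Ω_k = {x ∈ [0,1]^k : x_1 ≤ x_2 ≤ … ≤ x_k} equipped with Lebesgue measure, is a complete orthonormal system: distinct tuples give orthogonal functions, each φ_{j_1,…,j_k} has L²(Ω_k)-norm 1, and the closed linear span of the family is all of L²(Ω_k). -/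
open MeasureTheory

/-- The order simplex `Ω_k = {x ∈ [0,1]^k : x_1 ≤ x_2 ≤ … ≤ x_k}`. -/
def orderSimplex (k : ℕ) : Set (Fin k → ℝ) :=
  {x | (∀ q, 0 ≤ x q ∧ x q ≤ 1) ∧ Monotone x}

/-- The function `φ_{j_1,…,j_k}(x) = 2^{k/2} det( sin(π j_p x_q) )_{p,q}`. -/
noncomputable def phiSin (k : ℕ) (jj : Fin k → ℕ) (x : Fin k → ℝ) : ℝ :=
  Real.sqrt 2 ^ k *
    Matrix.det (Matrix.of fun p q : Fin k => Real.sin (Real.pi * (jj p : ℝ) * x q))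


noncomputable def antiExt (k : ℕ) (g : (Fin k → ℝ) → ℝ) (y : Fin k → ℝ) : ℝ :=
  ∑ σ : Equiv.Perm (Fin k), ((Equiv.Perm.sign σ : ℤ) : ℝ) *
    (orderSimplex k).indicator g (fun i => y (σ i))

theorem measPres_perm {k : ℕ} (σ : Equiv.Perm (Fin k)) :
    MeasurePreserving (fun (y : Fin k → ℝ) i => y (σ i)) volume volume := by
  have h := (volume_measurePreserving_piCongrLeft (fun _ : Fin k => ℝ) σ).symm
  exact h

theorem measEmb_perm {k : ℕ} (σ : Equiv.Perm (Fin k)) :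
    MeasurableEmbedding (fun (y : Fin k → ℝ) i => y (σ i)) := by
  have h := ((MeasurableEquiv.piCongrLeft (fun _ : Fin k => ℝ) σ).symm).measurableEmbedding
  exact h

theorem isClosed_orderSimplex (k : ℕ) : IsClosed (orderSimplex k) := by
  have : orderSimplex k = (⋂ q, {x : Fin k → ℝ | 0 ≤ x q} ∩ {x | x q ≤ 1}) ∩
      (⋂ p, ⋂ q, ⋂ (_ : p ≤ q), {x : Fin k → ℝ | x p ≤ x q}) := by
    ext x; simp [orderSimplex, Monotone]
  rw [this]
  refine IsClosed.inter (isClosed_iInter fun q => IsClosed.inter ?_ ?_)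
    (isClosed_iInter fun p => isClosed_iInter fun q => isClosed_iInter fun _ => ?_)
  · exact isClosed_le (by fun_prop) (by fun_prop)
  · exact isClosed_le (by fun_prop) (by fun_prop)
  · exact isClosed_le (by fun_prop) (by fun_prop)

theorem meas_orderSimplex (k : ℕ) : MeasurableSet (orderSimplex k) :=
  (isClosed_orderSimplex k).measurableSet

def cubeS (k : ℕ) : Set (Fin k → ℝ) := Set.univ.pi fun _ => Set.Icc (0 : ℝ) 1

theorem mem_cubeS {k : ℕ} {x : Fin k → ℝ} : x ∈ cubeS k ↔ ∀ q, 0 ≤ x q ∧ x q ≤ 1 := by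
  simp only [cubeS, Set.mem_univ_pi, Set.mem_Icc]

theorem isCompact_cubeS (k : ℕ) : IsCompact (cubeS k) :=
  isCompact_univ_pi fun _ => isCompact_Icc

theorem orderSimplex_sub (k : ℕ) : orderSimplex k ⊆ cubeS k :=
  fun _ hx => mem_cubeS.2 hx.1

theorem isCompact_orderSimplex (k : ℕ) : IsCompact (orderSimplex k) :=
  (isCompact_cubeS k).of_isClosed_subset (isClosed_orderSimplex k) (orderSimplex_sub k)

instance finMeas (k : ℕ) : IsFiniteMeasure (volume.restrict (orderSimplex k)) :=
  ⟨by simpa using (isCompact_orderSimplex k).measure_lt_top⟩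

theorem ae_inj (k : ℕ) : ∀ᵐ y : Fin k → ℝ, Function.Injective y := by
  have h : ∀ p q : Fin k, p ≠ q → ∀ᵐ y : Fin k → ℝ, y p ≠ y q := by
    intro p q hpq
    have := Measure.addHaar_submodule (volume : Measure (Fin k → ℝ))
      (LinearMap.ker (LinearMap.proj (R := ℝ) (φ := fun _ : Fin k => ℝ) p - LinearMap.proj q)) (by
        intro h
        have h2 : Pi.single p (1:ℝ) ∈ (LinearMap.ker (LinearMap.proj (R := ℝ) (φ := fun _ : Fin k => ℝ) p - LinearMap.proj q)) := by
          rw [h]; trivial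
        simp [hpq.symm] at h2)
    rw [ae_iff]
    convert this using 2
    ext y; simp [sub_eq_zero]
  have h2 : ∀ᵐ y : Fin k → ℝ, ∀ p q : Fin k, p ≠ q → y p ≠ y q := by
    rw [ae_all_iff]; intro p; rw [ae_all_iff]; intro q
    by_cases hpq : p = q
    · simp [hpq]
    · simpa [hpq] using h p q hpq
  filter_upwards [h2] with y hy p q hpq
  by_contra hne
  exact hy p q hne hpq

theorem int_ind {k : ℕ} {g : (Fin k → ℝ) → ℝ}
    (hg : IntegrableOn g (orderSimplex k)) (σ : Equiv.Perm (Fin k)) :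
    Integrable (fun y : Fin k → ℝ => (orderSimplex k).indicator g (fun i => y (σ i))) := by
  have := hg.integrable_indicator (meas_orderSimplex k)
  exact (measPres_perm σ).integrable_comp_of_integrable this

theorem int_antiExt {k : ℕ} {g : (Fin k → ℝ) → ℝ}
    (hg : IntegrableOn g (orderSimplex k)) : Integrable (antiExt k g) := by
  unfold antiExt
  exact integrable_finsetSum _ fun σ _ => (int_ind hg σ).const_mul _

theorem bdd_prod {k : ℕ} {f : Fin k → ℝ → ℝ} (hb : ∀ p t, |f p t| ≤ 1) (y : Fin k → ℝ) :
    ‖∏ p, f p (y p)‖ ≤ 1 := by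
  rw [Real.norm_eq_abs, Finset.abs_prod]
  exact Finset.prod_le_one (fun _ _ => abs_nonneg _) fun p _ => hb p _

theorem int_mul_prod {k : ℕ} {F : (Fin k → ℝ) → ℝ} {μ : Measure (Fin k → ℝ)} (hF : Integrable F μ)
    {f : Fin k → ℝ → ℝ} (hf : ∀ p, Continuous (f p)) (hb : ∀ p t, |f p t| ≤ 1) :
    Integrable (fun y => F y * ∏ p, f p (y p)) μ := by
  refine hF.mul_bdd (c := 1) ?_ (Filter.Eventually.of_forall fun y => bdd_prod hb y)
  have : Continuous (fun y : Fin k → ℝ => ∏ p, f p (y p)) := by fun_prop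
  exact this.aestronglyMeasurable

theorem key_int {k : ℕ} {g : (Fin k → ℝ) → ℝ}
    (hg : IntegrableOn g (orderSimplex k))
    {f : Fin k → ℝ → ℝ} (hf : ∀ p, Continuous (f p)) (hb : ∀ p t, |f p t| ≤ 1) :
    ∫ y, antiExt k g y * ∏ p, f p (y p) =
      ∫ x in orderSimplex k, g x * Matrix.det (Matrix.of fun p q : Fin k => f p (x q)) := by
  have h1 : ∀ y, antiExt k g y * ∏ p, f p (y p) = ∑ σ : Equiv.Perm (Fin k),
      ((Equiv.Perm.sign σ : ℤ) : ℝ) *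
      ((orderSimplex k).indicator g (fun i => y (σ i)) * ∏ p, f p (y p)) := by
    intro y; rw [antiExt, Finset.sum_mul]; simp only [mul_assoc]
  simp_rw [h1]
  rw [integral_finsetSum _ fun σ _ => (int_mul_prod (int_ind hg σ) hf hb).const_mul _]
  have h2 : ∀ x, g x * Matrix.det (Matrix.of fun p q : Fin k => f p (x q)) =
      ∑ σ : Equiv.Perm (Fin k), ((Equiv.Perm.sign σ : ℤ) : ℝ) * (g x * ∏ p, f (σ p) (x p)) := by
    intro x; rw [Matrix.det_apply', Finset.mul_sum]
    refine Finset.sum_congr rfl fun σ _ => ?_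
    simp only [Matrix.of_apply]; ring
  simp_rw [h2]
  rw [integral_finsetSum _ fun σ _ => (int_mul_prod hg (fun p => hf (σ p))
    (fun p => hb (σ p))).const_mul _]
  refine Finset.sum_congr rfl fun σ _ => ?_
  rw [integral_const_mul, integral_const_mul]
  congr 1
  rw [← integral_indicator (meas_orderSimplex k),
    ← (measPres_perm σ).integral_comp (measEmb_perm σ)
      ((orderSimplex k).indicator fun x => g x * ∏ p, f (σ p) (x p))]
  refine integral_congr_ae (Filter.Eventually.of_forall fun y => ?_)
  simp only [Set.indicator]
  split_ifs
  · rw [← Equiv.prod_comp σ (fun p => f p (y p))]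
  · simp

theorem antiExt_of {k : ℕ} (g : (Fin k → ℝ) → ℝ) {y : Fin k → ℝ} (hy : Function.Injective y)
    (σ : Equiv.Perm (Fin k)) (hσ : (fun i => y (σ i)) ∈ orderSimplex k) :
    antiExt k g y = ((Equiv.Perm.sign σ : ℤ) : ℝ) * g (fun i => y (σ i)) := by
  unfold antiExt
  rw [Finset.sum_eq_single σ]
  · rw [Set.indicator_of_mem hσ]
  · intro τ _ hτ
    rw [Set.indicator_of_notMem, mul_zero]
    intro h
    apply hτ
    have := Tuple.unique_monotone (f := y) (σ := τ) (τ := σ) h.2 hσ.2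
    ext i
    exact congrArg Fin.val (hy (congrFun this i))
  · simp

theorem antiExt_zero {k : ℕ} (g : (Fin k → ℝ) → ℝ) {y : Fin k → ℝ} (hy : y ∉ cubeS k) :
    antiExt k g y = 0 := by
  unfold antiExt
  refine Finset.sum_eq_zero fun σ _ => ?_
  rw [Set.indicator_of_notMem, mul_zero]
  intro h
  apply hy
  rw [mem_cubeS]
  intro q
  simpa using h.1 (σ.symm q)

theorem phiSin_perm {k : ℕ} (jj : Fin k → ℕ) (σ : Equiv.Perm (Fin k)) (y : Fin k → ℝ) :
    phiSin k jj (fun i => y (σ i)) = ((Equiv.Perm.sign σ : ℤ) : ℝ) * phiSin k jj y := by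
  unfold phiSin
  have := Matrix.det_permute' σ (Matrix.of fun p q : Fin k => Real.sin (Real.pi * (jj p : ℝ) * y q))
  have h2 : (Matrix.of fun p q : Fin k => Real.sin (Real.pi * (jj p : ℝ) * y (σ q))) =
    (Matrix.of fun p q : Fin k => Real.sin (Real.pi * (jj p : ℝ) * y q)).submatrix id σ := rfl
  rw [h2, this]; ring

theorem antiExt_phi {k : ℕ} (jj : Fin k → ℕ) :
    antiExt k (phiSin k jj) =ᵐ[volume] (cubeS k).indicator (phiSin k jj) := by
  filter_upwards [ae_inj k] with y hy
  by_cases hc : y ∈ cubeS k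
  · rw [Set.indicator_of_mem hc, antiExt_of _ hy (Tuple.sort y)
      ⟨fun q => mem_cubeS.1 hc _, Tuple.monotone_sort y⟩, phiSin_perm, ← mul_assoc]
    norm_cast
    rw [Int.units_mul_self]; simp
  · rw [Set.indicator_of_notMem hc, antiExt_zero _ hc]

theorem sinInt (i j : ℕ) (hi : 0 < i) (hj : 0 < j) :
    ∫ t in Set.Icc (0:ℝ) 1, Real.sin (Real.pi * i * t) * Real.sin (Real.pi * j * t) =
      if i = j then 1 / 2 else 0 := by
  rw [integral_Icc_eq_integral_Ioc, ← intervalIntegral.integral_of_le zero_le_one]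
  have hc : ∀ n : ℤ, n ≠ 0 → ∫ t in (0:ℝ)..1, Real.cos (Real.pi * n * t) = 0 := by
    intro n hn
    have hne : Real.pi * n ≠ 0 := mul_ne_zero Real.pi_ne_zero (by exact_mod_cast hn)
    rw [intervalIntegral.integral_comp_mul_left (fun t => Real.cos t) hne]
    simp [mul_comm Real.pi]
  have h : ∀ t : ℝ, Real.sin (Real.pi * i * t) * Real.sin (Real.pi * j * t) =
      (1/2) * (Real.cos (Real.pi * ((i - j : ℤ) : ℝ) * t) - Real.cos (Real.pi * ((i + j : ℤ) : ℝ) * t)) := by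
    intro t
    have e1 : Real.pi * ((i - j : ℤ) : ℝ) * t = Real.pi * i * t - Real.pi * j * t := by push_cast; ring
    have e2 : Real.pi * ((i + j : ℤ) : ℝ) * t = Real.pi * i * t + Real.pi * j * t := by push_cast; ring
    rw [e1, e2, Real.cos_sub, Real.cos_add]; ring
  simp_rw [h]
  rw [intervalIntegral.integral_const_mul, intervalIntegral.integral_sub
    (Continuous.intervalIntegrable (by fun_prop) _ _)
    (Continuous.intervalIntegrable (by fun_prop) _ _), hc (i + j) (by omega)]
  split_ifs with hij
  · subst hij; simp
  · rw [hc (i - j) (by omega)]; simp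

theorem cont_phi {k : ℕ} (jj : Fin k → ℕ) : Continuous (phiSin k jj) := by
  unfold phiSin
  refine continuous_const.mul (Continuous.matrix_det ?_)
  refine continuous_matrix fun p q => ?_
  simp only [Matrix.of_apply]
  fun_prop

theorem phi_inner {k : ℕ} (i j : Fin k → ℕ) (hi : StrictAnti i) (hj : StrictAnti j)
    (hi0 : ∀ p, 0 < i p) (hj0 : ∀ p, 0 < j p) :
    ∫ x in orderSimplex k, phiSin k i x * phiSin k j x = if i = j then 1 else 0 := by
  have hg : IntegrableOn (phiSin k i) (orderSimplex k) :=
    (cont_phi i).continuousOn.integrableOn_compact (isCompact_orderSimplex k)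
  have hk := key_int hg (f := fun p t => Real.sin (Real.pi * (j p : ℝ) * t))
    (fun p => by fun_prop) (fun p t => Real.abs_sin_le_one _)
  have h1 : ∫ x in orderSimplex k, phiSin k i x * phiSin k j x =
      Real.sqrt 2 ^ k * ∫ y, antiExt k (phiSin k i) y * ∏ p, Real.sin (Real.pi * (j p : ℝ) * y p) := by
    rw [hk, ← integral_const_mul]
    congr 1; ext x
    rw [phiSin.eq_1 k j]; ring
  have h2 : ∫ y, antiExt k (phiSin k i) y * ∏ p, Real.sin (Real.pi * (j p : ℝ) * y p) =
      ∫ y in cubeS k, phiSin k i y * ∏ p, Real.sin (Real.pi * (j p : ℝ) * y p) := by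
    rw [← integral_indicator (isCompact_cubeS k).measurableSet]
    refine integral_congr_ae ?_
    filter_upwards [antiExt_phi i] with y hy
    rw [hy, Set.indicator_mul_left]
  have h3 : ∀ y : Fin k → ℝ, phiSin k i y * ∏ p, Real.sin (Real.pi * (j p : ℝ) * y p) =
      Real.sqrt 2 ^ k * ∑ σ : Equiv.Perm (Fin k), ((Equiv.Perm.sign σ : ℤ) : ℝ) *
        ∏ p, (Real.sin (Real.pi * (i (σ p) : ℝ) * y p) * Real.sin (Real.pi * (j p : ℝ) * y p)) := by
    intro y
    rw [phiSin, Matrix.det_apply', mul_assoc, Finset.sum_mul]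
    congr 1
    refine Finset.sum_congr rfl fun σ _ => ?_
    rw [Finset.prod_mul_distrib]; simp only [Matrix.of_apply]; ring
  rw [h1, h2]
  simp_rw [h3]
  rw [integral_const_mul, integral_finsetSum]
  swap
  · intro σ _
    refine Integrable.const_mul ?_ _
    refine ContinuousOn.integrableOn_compact (isCompact_cubeS k) ?_
    exact Continuous.continuousOn (by fun_prop)
  have h4 : ∀ σ : Equiv.Perm (Fin k), ∫ y in cubeS k, ((Equiv.Perm.sign σ : ℤ) : ℝ) *
        ∏ p, (Real.sin (Real.pi * (i (σ p) : ℝ) * y p) * Real.sin (Real.pi * (j p : ℝ) * y p)) =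
        if σ = 1 ∧ i = j then (1/2)^k else 0 := by
    intro σ
    rw [integral_const_mul, cubeS, volume_pi, Measure.restrict_pi_pi,
      integral_fintype_prod_eq_prod (fun p t => Real.sin (Real.pi * (i (σ p) : ℝ) * t) *
        Real.sin (Real.pi * (j p : ℝ) * t))]
    simp_rw [fun p => sinInt (i (σ p)) (j p) (hi0 _) (hj0 p)]
    split_ifs with h
    · obtain ⟨rfl, rfl⟩ := h
      simp
    · by_cases hh : ∀ p, i (σ p) = j p
      · exfalso
        apply h
        have e0 : i ∘ σ = j := funext hh
        have := Tuple.unique_antitone (f := i) (σ := σ) (τ := 1) (by rw [e0]; exact hj.antitone)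
          hi.antitone
        refine ⟨?_, ?_⟩
        · ext p; exact congrArg Fin.val (hi.injective (congrFun this p))
        · rw [← e0, this]; rfl
      · push Not at hh
        obtain ⟨p, hp⟩ := hh
        rw [Finset.prod_eq_zero (Finset.mem_univ p) (by simp [hp]), mul_zero]
  simp_rw [h4]
  by_cases hij : i = j
  · simp only [hij, and_true, Finset.sum_ite_eq', Finset.mem_univ, if_true]
    rw [← mul_pow, ← mul_pow, ← mul_assoc, Real.mul_self_sqrt (by norm_num)]; norm_num
  · simp [hij]

theorem trig_zero {k : ℕ} {G : (Fin k → ℝ) → ℝ} (hG : Integrable G)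
    (h0 : ∀ j : Fin k → ℕ, ∫ y, G y * ∏ p, Real.sin (Real.pi * (j p : ℝ) * y p) = 0) :
    ∀ (n : ℕ) (m j : Fin k → ℕ), ∑ p, m p = n →
      ∫ y, G y * ∏ p, (Real.sin (Real.pi * (j p : ℝ) * y p) * Real.cos (Real.pi * y p) ^ m p) = 0 := by
  intro n
  induction n with
  | zero =>
    intro m j hm
    have : ∀ p, m p = 0 := by simpa using hm
    simpa [this] using h0 j
  | succ n ih =>
    intro m j hm
    by_cases hj : ∃ p, j p = 0
    · obtain ⟨p, hp⟩ := hj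
      have : ∀ y : Fin k → ℝ, ∏ p, (Real.sin (Real.pi * (j p : ℝ) * y p) * Real.cos (Real.pi * y p) ^ m p) = 0 :=
        fun y => Finset.prod_eq_zero (Finset.mem_univ p) (by simp [hp])
      simp [this]
    push Not at hj
    obtain ⟨p, hp⟩ : ∃ p, m p ≠ 0 := by
      by_contra hcon
      push Not at hcon
      simp [hcon] at hm
    set m' := Function.update m p (m p - 1) with hm'
    have hm's : ∑ q, m' q = n := by
      have e1 := Finset.add_sum_erase Finset.univ m (Finset.mem_univ p)
      have e2 := Finset.add_sum_erase Finset.univ m' (Finset.mem_univ p)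
      have e3 : ∑ q ∈ Finset.univ.erase p, m' q = ∑ q ∈ Finset.univ.erase p, m q :=
        Finset.sum_congr rfl fun q hq => by simp [hm', Finset.ne_of_mem_erase hq]
      have e4 : m' p = m p - 1 := by simp [hm']
      omega
    have key : ∀ y : Fin k → ℝ,
        G y * ∏ p, (Real.sin (Real.pi * (j p : ℝ) * y p) * Real.cos (Real.pi * y p) ^ m p) =
        (1/2) * (G y * ∏ q, (Real.sin (Real.pi * (Function.update j p (j p + 1) q : ℝ) * y q) * Real.cos (Real.pi * y q) ^ m' q)) +
        (1/2) * (G y * ∏ q, (Real.sin (Real.pi * (Function.update j p (j p - 1) q : ℝ) * y q) * Real.cos (Real.pi * y q) ^ m' q)) := by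
      intro y
      rw [← Finset.mul_prod_erase _ _ (Finset.mem_univ p), ← Finset.mul_prod_erase _ _ (Finset.mem_univ p),
        ← Finset.mul_prod_erase _ _ (Finset.mem_univ p)]
      have e : ∀ c, ∏ q ∈ Finset.univ.erase p, (Real.sin (Real.pi * (Function.update j p c q : ℝ) * y q) * Real.cos (Real.pi * y q) ^ m' q)
         = ∏ q ∈ Finset.univ.erase p, (Real.sin (Real.pi * (j q : ℝ) * y q) * Real.cos (Real.pi * y q) ^ m q) := by
        intro c
        refine Finset.prod_congr rfl fun q hq => ?_
        simp [hm', Finset.ne_of_mem_erase hq]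
      rw [e, e]
      obtain ⟨a, ha⟩ := Nat.exists_eq_succ_of_ne_zero hp
      obtain ⟨b, hb⟩ := Nat.exists_eq_succ_of_ne_zero (hj p)
      have f1 : m' p = a := by simp [hm', ha]
      rw [f1, Function.update_self, Function.update_self, ha, hb]
      have g1 : Real.pi * ((b.succ + 1 : ℕ) : ℝ) * y p = Real.pi * (b.succ : ℝ) * y p + Real.pi * y p := by
        push_cast; ring
      have g2 : Real.pi * ((b.succ - 1 : ℕ) : ℝ) * y p = Real.pi * (b.succ : ℝ) * y p - Real.pi * y p := by
        simp only [Nat.succ_sub_one]; push_cast; ring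
      rw [g1, g2, Real.sin_add, Real.sin_sub, pow_succ]
      ring
    have hint : ∀ j' m' : Fin k → ℕ, Integrable fun y : Fin k → ℝ =>
        G y * ∏ q, (Real.sin (Real.pi * (j' q : ℝ) * y q) * Real.cos (Real.pi * y q) ^ m' q) := by
      intro j' m'
      refine int_mul_prod hG (f := fun q t => Real.sin (Real.pi * (j' q : ℝ) * t) * Real.cos (Real.pi * t) ^ m' q)
        (fun q => by fun_prop) fun q t => ?_
      rw [abs_mul, abs_pow]
      exact mul_le_one₀ (Real.abs_sin_le_one _) (by positivity) (pow_le_one₀ (abs_nonneg _) (Real.abs_cos_le_one _))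
    simp_rw [key]
    rw [integral_add ((hint _ _).const_mul _) ((hint _ _).const_mul _), integral_const_mul,
      integral_const_mul, ih _ _ hm's, ih _ _ hm's]
    simp

theorem poly_zero {k : ℕ} {H : (Fin k → ℝ) → ℝ} (hH : Integrable H)
    (h0 : ∀ m : Fin k → ℕ, ∫ y, H y * ∏ p, Real.cos (Real.pi * y p) ^ m p = 0)
    (P : MvPolynomial (Fin k) ℝ) :
    Integrable (fun y => H y * MvPolynomial.eval (fun p => Real.cos (Real.pi * y p)) P) ∧
    ∫ y, H y * MvPolynomial.eval (fun p => Real.cos (Real.pi * y p)) P = 0 := by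
  induction P using MvPolynomial.induction_on' with
  | monomial u a =>
    have e : ∀ y : Fin k → ℝ, H y * MvPolynomial.eval (fun p => Real.cos (Real.pi * y p)) (MvPolynomial.monomial u a)
      = a * (H y * ∏ p, Real.cos (Real.pi * y p) ^ u p) := by
      intro y
      rw [MvPolynomial.eval_monomial, Finsupp.prod_fintype _ _ (by simp)]; ring
    simp_rw [e]
    constructor
    · refine Integrable.const_mul ?_ _
      refine int_mul_prod hH (f := fun q t => Real.cos (Real.pi * t) ^ u q)
        (fun q => by fun_prop) fun q t => ?_
      rw [abs_pow]
      exact pow_le_one₀ (abs_nonneg _) (Real.abs_cos_le_one _)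
    · rw [integral_const_mul, h0, mul_zero]
  | add p q hp hq =>
    simp only [map_add, mul_add]
    exact ⟨hp.1.add hq.1, by rw [integral_add hp.1 hq.1, hp.2, hq.2, add_zero]⟩

noncomputable def cosMap (k : ℕ) (p : Fin k) : C(cubeS k, ℝ) :=
  ⟨fun y => Real.cos (Real.pi * y.1 p),
    Real.continuous_cos.comp (continuous_const.mul ((continuous_apply p).comp continuous_subtype_val))⟩

theorem cont_zero {k : ℕ} {H : (Fin k → ℝ) → ℝ} (hH : Integrable H)
    (hs : ∀ y, y ∉ cubeS k → H y = 0)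
    (h0 : ∀ m : Fin k → ℕ, ∫ y, H y * ∏ p, Real.cos (Real.pi * y p) ^ m p = 0)
    (f : (Fin k → ℝ) → ℝ) (hf : Continuous f) :
    ∫ y, f y * H y = 0 := by
  have : CompactSpace (cubeS k) := isCompact_iff_compactSpace.mp (isCompact_cubeS k)
  set A : Subalgebra ℝ C(cubeS k, ℝ) := Algebra.adjoin ℝ (Set.range (cosMap k)) with hA
  have hsep : A.SeparatesPoints := by
    intro x y hxy
    have : ∃ p, x.1 p ≠ y.1 p := by
      by_contra hc
      push Not at hc
      exact hxy (Subtype.ext (funext hc))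
    obtain ⟨p, hp⟩ := this
    refine ⟨cosMap k p, ⟨cosMap k p, Algebra.subset_adjoin ⟨p, rfl⟩, rfl⟩, ?_⟩
    intro h
    apply hp
    have hx := mem_cubeS.1 x.2 p
    have hy := mem_cubeS.1 y.2 p
    have := Real.injOn_cos (x₁ := Real.pi * x.1 p) (x₂ := Real.pi * y.1 p)
      ⟨by have := Real.pi_pos; nlinarith, by have := Real.pi_pos; nlinarith⟩
      ⟨by have := Real.pi_pos; nlinarith, by have := Real.pi_pos; nlinarith⟩ h
    exact mul_left_cancel₀ Real.pi_ne_zero this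
  have hbound : ∀ ε > 0, |∫ y, f y * H y| ≤ ε * ∫ y, |H y| := by
    intro ε hε
    obtain ⟨⟨g, hgA⟩, hg⟩ := ContinuousMap.exists_mem_subalgebra_near_continuous_of_separatesPoints A hsep
      (fun y => f y.1) (by fun_prop) ε hε
    rw [hA, Algebra.adjoin_range_eq_range_aeval] at hgA
    obtain ⟨P, rfl⟩ := hgA
    have hev : ∀ y : cubeS k, (MvPolynomial.aeval (cosMap k) P : C(cubeS k, ℝ)) y =
        MvPolynomial.eval (fun p => Real.cos (Real.pi * y.1 p)) P := by
      intro y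
      have h1 := MvPolynomial.map_aeval (cosMap k) ((ContinuousMap.evalAlgHom ℝ ℝ y : C(cubeS k, ℝ) →ₐ[ℝ] ℝ) : C(cubeS k, ℝ) →+* ℝ) P
      have h2 : (((ContinuousMap.evalAlgHom ℝ ℝ y : C(cubeS k, ℝ) →ₐ[ℝ] ℝ) : C(cubeS k, ℝ) →+* ℝ)).comp (algebraMap ℝ C(cubeS k, ℝ)) = RingHom.id ℝ := by
        ext r; simp
      rw [h2] at h1
      exact h1
    obtain ⟨hPi, hP0⟩ := poly_zero hH h0 P
    have hpt : ∀ y, ‖f y * H y - H y * MvPolynomial.eval (fun p => Real.cos (Real.pi * y p)) P‖ ≤ ε * |H y| := by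
      intro y
      by_cases hy : y ∈ cubeS k
      · have := hg ⟨y, hy⟩
        simp only at this
        erw [hev ⟨y, hy⟩] at this
        rw [mul_comm (f y), ← mul_sub, norm_mul, mul_comm ε, norm_sub_rev]
        exact mul_le_mul_of_nonneg_left this.le (abs_nonneg _)
      · simp [hs y hy]
    have hmeas : AEStronglyMeasurable (fun y => f y * H y) volume :=
      hf.aestronglyMeasurable.mul hH.1
    have hdi : Integrable (fun y => f y * H y - H y * MvPolynomial.eval (fun p => Real.cos (Real.pi * y p)) P) :=
      (hH.abs.const_mul ε).mono' (hmeas.sub hPi.1) (Filter.Eventually.of_forall hpt)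
    have hfi : Integrable (fun y => f y * H y) := by
      refine (hdi.add hPi).congr (Filter.Eventually.of_forall fun y => ?_)
      simp
    have : ∫ y, f y * H y = ∫ y, (f y * H y - H y * MvPolynomial.eval (fun p => Real.cos (Real.pi * y p)) P) := by
      rw [integral_sub hfi hPi, hP0, sub_zero]
    rw [this, ← integral_const_mul]
    exact norm_integral_le_of_norm_le (hH.abs.const_mul ε) (Filter.Eventually.of_forall hpt)
  have hI : 0 ≤ ∫ y, |H y| := integral_nonneg fun y => abs_nonneg _
  rw [← abs_eq_zero]
  refine le_antisymm (le_of_forall_pos_le_add fun δ hδ => ?_) (abs_nonneg _)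
  have := hbound (δ / ((∫ y, |H y|) + 1)) (by positivity)
  rw [zero_add]
  refine this.trans ?_
  rw [div_mul_eq_mul_div, div_le_iff₀ (by positivity)]
  nlinarith

theorem sin_complete {k : ℕ} {G : (Fin k → ℝ) → ℝ} (hG : Integrable G)
    (hs : ∀ y, y ∉ cubeS k → G y = 0)
    (h0 : ∀ j : Fin k → ℕ, ∫ y, G y * ∏ p, Real.sin (Real.pi * (j p : ℝ) * y p) = 0) :
    ∀ᵐ y, G y = 0 := by
  set H : (Fin k → ℝ) → ℝ := fun y => G y * ∏ p, Real.sin (Real.pi * y p) with hHd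
  have hH : Integrable H := int_mul_prod hG (f := fun _ t => Real.sin (Real.pi * t))
    (fun p => by fun_prop) fun p t => Real.abs_sin_le_one _
  have hHs : ∀ y, y ∉ cubeS k → H y = 0 := fun y hy => by simp [hHd, hs y hy]
  have hH0 : ∀ m : Fin k → ℕ, ∫ y, H y * ∏ p, Real.cos (Real.pi * y p) ^ m p = 0 := by
    intro m
    have := trig_zero hG h0 _ m (fun _ => 1) rfl
    simpa [hHd, Finset.prod_mul_distrib, mul_assoc] using this
  have hz : ∀ᵐ y, H y = 0 := by
    refine ae_eq_zero_of_integral_contDiff_smul_eq_zero hH.locallyIntegrable fun g hg _ => ?_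
    simpa using cont_zero hH hHs hH0 g hg.continuous
  have hne : ∀ᵐ y : Fin k → ℝ, ∀ p, y p ≠ 0 ∧ y p ≠ 1 := by
    rw [ae_all_iff]
    intro p
    exact (Measure.ae_eval_ne (fun _ : Fin k => (volume : Measure ℝ)) p 0).and
      (Measure.ae_eval_ne (fun _ : Fin k => (volume : Measure ℝ)) p 1)
  filter_upwards [hz, hne] with y hy hn
  by_cases hc : y ∈ cubeS k
  · rcases mul_eq_zero.1 hy with h | h
    · exact h
    · exfalso
      obtain ⟨p, -, hp⟩ := Finset.prod_eq_zero_iff.1 h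
      have hc := mem_cubeS.1 hc p
      have h1 : 0 < y p := lt_of_le_of_ne hc.1 (hn p).1.symm
      have h2 : y p < 1 := lt_of_le_of_ne hc.2 (hn p).2
      have := Real.sin_pos_of_pos_of_lt_pi (x := Real.pi * y p) (by have := Real.pi_pos; positivity)
        (by have := Real.pi_pos; nlinarith)
      exact this.ne' hp
  · exact hs y hc

theorem simplex_complete {k : ℕ} {g : (Fin k → ℝ) → ℝ} (hg : IntegrableOn g (orderSimplex k))
    (h0 : ∀ j : Fin k → ℕ, StrictAnti j → (∀ p, 0 < j p) →
      ∫ x in orderSimplex k, g x * phiSin k j x = 0) :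
    ∀ᵐ x ∂(volume.restrict (orderSimplex k)), g x = 0 := by
  have hdet : ∀ j : Fin k → ℕ, ∫ x in orderSimplex k, g x *
      Matrix.det (Matrix.of fun p q : Fin k => Real.sin (Real.pi * (j p : ℝ) * x q)) = 0 := by
    intro j
    by_cases hz : ∃ p, j p = 0
    · obtain ⟨p, hp⟩ := hz
      have : ∀ x : Fin k → ℝ, Matrix.det (Matrix.of fun p q : Fin k => Real.sin (Real.pi * (j p : ℝ) * x q)) = 0 :=
        fun x => Matrix.det_eq_zero_of_row_eq_zero p fun q => by simp [hp]
      simp [this]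
    push Not at hz
    by_cases hi : Function.Injective j
    swap
    · rw [Function.Injective] at hi
      push Not at hi
      obtain ⟨p, q, hpq, hne⟩ := hi
      have : ∀ x : Fin k → ℝ, Matrix.det (Matrix.of fun p q : Fin k => Real.sin (Real.pi * (j p : ℝ) * x q)) = 0 :=
        fun x => Matrix.det_zero_of_row_eq hne (by ext r; simp [hpq])
      simp [this]
    set σ : Equiv.Perm (Fin k) := Fin.revPerm.trans (Tuple.sort j) with hσ
    have hanti : StrictAnti (fun p => j (σ p)) := by
      have hm : StrictMono (j ∘ Tuple.sort j) :=
        (Tuple.monotone_sort j).strictMono_of_injective (hi.comp (Equiv.injective _))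
      intro a b hab
      exact hm (Fin.rev_lt_rev.2 hab)
    have := h0 _ hanti fun p => Nat.pos_of_ne_zero (hz _)
    have hph : ∀ x, phiSin k (fun p => j (σ p)) x = (Real.sqrt 2 ^ k * ((Equiv.Perm.sign σ : ℤ) : ℝ)) *
        Matrix.det (Matrix.of fun p q : Fin k => Real.sin (Real.pi * (j p : ℝ) * x q)) := by
      intro x
      have h2 := Matrix.det_permute σ (Matrix.of fun p q : Fin k => Real.sin (Real.pi * (j p : ℝ) * x q))
      rw [mul_assoc, ← h2]; rfl
    have hre : ∀ x, g x * phiSin k (fun p => j (σ p)) x = (Real.sqrt 2 ^ k * ((Equiv.Perm.sign σ : ℤ) : ℝ)) *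
        (g x * Matrix.det (Matrix.of fun p q : Fin k => Real.sin (Real.pi * (j p : ℝ) * x q))) := by
      intro x; rw [hph]; ring
    simp_rw [hre] at this
    rw [integral_const_mul] at this
    refine (mul_eq_zero.1 this).resolve_left (mul_ne_zero (by positivity) ?_)
    exact_mod_cast (Equiv.Perm.sign σ).ne_zero
  have hG0 := sin_complete (int_antiExt hg) (fun y hy => antiExt_zero g hy) fun j => by
    have := key_int hg (f := fun p t => Real.sin (Real.pi * (j p : ℝ) * t))
      (fun p => by fun_prop) (fun p t => Real.abs_sin_le_one _)
    rw [this, hdet j]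
  rw [ae_restrict_iff' (meas_orderSimplex k)]
  filter_upwards [hG0, ae_inj k] with y hy hinj hmem
  have := antiExt_of g hinj 1 hmem
  rw [hy] at this
  simpa using this.symm
/-- **Completeness of the `(2k+1)`-strip eigensystem.** The family
`φ_{j_1,…,j_k}`, indexed by tuples `j_1 > … > j_k > 0`, is a complete
orthonormal system in `L²(Ω_k)`: any family of `L²` elements representing
these functions is orthonormal, and its closed linear span is everything. -/
theorem sin_eigensystem_complete (k : ℕ) (hk : 1 ≤ k)
    (e : {jj : Fin k → ℕ // (∀ p q : Fin k, p < q → jj q < jj p) ∧ ∀ p, 0 < jj p} →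
      Lp ℝ 2 (volume.restrict (orderSimplex k)))
    (he : ∀ jj, (e jj : (Fin k → ℝ) → ℝ)
        =ᵐ[volume.restrict (orderSimplex k)] phiSin k jj.1) :
    Orthonormal ℝ e ∧ (Submodule.span ℝ (Set.range e)).topologicalClosure = ⊤ := by


  have hin : ∀ (f : Lp ℝ 2 (volume.restrict (orderSimplex k))) (jj), inner ℝ f (e jj) =
      ∫ x in orderSimplex k, f x * phiSin k jj.1 x := by
    intro f jj
    rw [L2.inner_def]
    refine integral_congr_ae ?_
    filter_upwards [he jj] with x hx
    rw [hx]; simp [mul_comm]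
  constructor
  · rw [orthonormal_iff_ite]
    intro i j
    rw [hin]
    have : ∫ x in orderSimplex k, e i x * phiSin k j.1 x =
        ∫ x in orderSimplex k, phiSin k i.1 x * phiSin k j.1 x := by
      refine integral_congr_ae ?_
      filter_upwards [he i] with x hx
      rw [hx]
    rw [this, phi_inner i.1 j.1 (fun p q h => i.2.1 p q h) (fun p q h => j.2.1 p q h) i.2.2 j.2.2]
    simp [Subtype.ext_iff]
  · rw [Submodule.topologicalClosure_eq_top_iff, Submodule.eq_bot_iff]
    intro f hf
    rw [Submodule.mem_orthogonal'] at hf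
    have hfi : IntegrableOn f (orderSimplex k) := (Lp.memLp f).integrable (by norm_num)
    have := simplex_complete hfi fun j hj hj0 => by
      rw [← hin f ⟨j, fun p q h => hj h, hj0⟩]
      exact hf _ (Submodule.subset_span ⟨_, rfl⟩)
    exact (Lp.eq_zero_iff_ae_eq_zero).2 this
end

section
/- Fix integers N ≥ 1 and p,q ≥ 0, and for an integer a ≥ 0 and integer j ≥ 1 let I(a,j) = (1/a!) ∫_0^1 x^a cos(π(2j−1)x/2) dx. Then X_N(p,q) = 2 · Σ_{j=1}^∞ ( 2(−1)^{j+1} / (π(2j−1)) )^N · I(p,j) · I(q,j), and the series on the right converges. -/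
/-- The number of up-down (alternating) permutations of `{1, …, j}`:
permutations with `σ(1) < σ(2) > σ(3) < σ(4) > ⋯`. -/
noncomputable def updownCount (j : ℕ) : ℕ :=
  Nat.card {σ : Equiv.Perm (Fin j) //
    ∀ i : Fin j, ∀ h : (i : ℕ) + 1 < j,
      if (i : ℕ) % 2 = 0 then σ i < σ ⟨(i : ℕ) + 1, h⟩
      else σ ⟨(i : ℕ) + 1, h⟩ < σ i}

/-- `Ā_j = A_j / j!`. -/
noncomputable def Abar (j : ℕ) : ℝ := (updownCount j : ℝ) / (Nat.factorial j : ℝ)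

/-- The quantity `X_N(p,q)` of Romik–Eremenko. -/
noncomputable def XN (N p q : ℕ) : ℝ :=
  (∑ i ∈ Finset.range (p / 2 + 1), ∑ j ∈ Finset.range (q / 2 + 1),
      (-1 : ℝ) ^ (i + j) * Abar (N + 2 * i + 2 * j + 1) /
        ((Nat.factorial (p - 2 * i) : ℝ) * (Nat.factorial (q - 2 * j) : ℝ)))
  + (if Odd p then
      (-1 : ℝ) ^ ((p + 1) / 2) * ∑ j ∈ Finset.range (q / 2 + 1),
        (-1 : ℝ) ^ j * Abar (N + p + 2 * j + 1) / (Nat.factorial (q - 2 * j) : ℝ)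
    else 0)
  + (if Odd q then
      (-1 : ℝ) ^ ((q + 1) / 2) * ∑ i ∈ Finset.range (p / 2 + 1),
        (-1 : ℝ) ^ i * Abar (N + q + 2 * i + 1) / (Nat.factorial (p - 2 * i) : ℝ)
    else 0)
  + (if Odd p ∧ Odd q then (-1 : ℝ) ^ ((p + q) / 2 + 1) * Abar (N + p + q + 1) else 0)

/-- `I(a,j) = (1/a!) ∫_0^1 x^a cos(π(2j−1)x/2) dx`. -/
noncomputable def Icoef (a j : ℕ) : ℝ :=
  (1 / (Nat.factorial a : ℝ)) *
    ∫ x in (0 : ℝ)..1, x ^ a * Real.cos (Real.pi * (2 * (j : ℝ) - 1) * x / 2)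

/-- up-down predicate -/
def UD (j : ℕ) (σ : Equiv.Perm (Fin j)) : Prop :=
  ∀ i : Fin j, ∀ h : (i : ℕ) + 1 < j,
      if (i : ℕ) % 2 = 0 then σ i < σ ⟨(i : ℕ) + 1, h⟩
      else σ ⟨(i : ℕ) + 1, h⟩ < σ i

/-- insertion of a new first value -/
def insG {n : ℕ} (k : Fin (n + 2)) (ρ : Equiv.Perm (Fin (n + 1))) : Equiv.Perm (Fin (n + 2)) :=
  (finSuccEquiv' 0).trans ((Equiv.optionCongr (ρ.trans Fin.revPerm)).trans (finSuccEquiv' k).symm)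

theorem insG_zero {n : ℕ} (k : Fin (n + 2)) (ρ : Equiv.Perm (Fin (n + 1))) : insG k ρ 0 = k := by
  simp [insG, finSuccEquiv'_zero]

theorem insG_succ {n : ℕ} (k : Fin (n + 2)) (ρ : Equiv.Perm (Fin (n + 1))) (i : Fin (n + 1)) :
    insG k ρ i.succ = k.succAbove (Fin.rev (ρ i)) := by
  simp [insG, finSuccEquiv'_zero]

theorem insG_inj {n : ℕ} (k : Fin (n + 2)) : Function.Injective (insG (n := n) k) := by
  intro a b h
  ext i
  have := congrArg (fun e => e i.succ) h
  simp only [insG_succ] at this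
  rw [Fin.succAbove_right_injective.eq_iff, Fin.rev_injective.eq_iff] at this
  rw [this]

theorem insG_surj {n : ℕ} (k : Fin (n + 2)) (σ : Equiv.Perm (Fin (n + 2))) (h : σ 0 = k) :
    ∃ ρ, insG k ρ = σ := by
  have h1 : ∀ i : Fin (n + 1), ∃ z, k.succAbove z = σ i.succ := by
    intro i
    apply Fin.exists_succAbove_eq
    rw [← h]
    intro h2
    exact Fin.succ_ne_zero i (σ.injective h2)
  choose z hz using h1
  have zi : Function.Injective z := by
    intro a b hab
    have := hz a
    rw [hab, hz b] at this
    exact (Fin.succ_injective _ (σ.injective this)).symm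
  refine ⟨(Equiv.ofBijective z (Finite.injective_iff_bijective.1 zi)).trans Fin.revPerm, ?_⟩
  ext i
  refine Fin.cases ?_ (fun i => ?_) i
  · rw [insG_zero, h]
  · rw [insG_succ, ← hz i]
    simp

theorem insG_UD {n : ℕ} (k : Fin (n + 2)) (ρ : Equiv.Perm (Fin (n + 1))) :
    UD (n + 2) (insG k ρ) ↔ UD (n + 1) ρ ∧ (ρ 0 : ℕ) + k < n + 1 := by
  have key0 : (insG k ρ 0 < insG k ρ (Fin.succ 0)) ↔ (ρ 0 : ℕ) + k < n + 1 := by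
    rw [insG_zero, insG_succ, Fin.lt_succAbove_iff_le_castSucc, Fin.le_def]
    simp only [Fin.val_castSucc, Fin.val_rev]
    have := (ρ 0).isLt
    omega
  have keyS : ∀ a b : Fin (n + 1), insG k ρ a.succ < insG k ρ b.succ ↔ ρ b < ρ a := by
    intro a b
    rw [insG_succ, insG_succ, Fin.succAbove_lt_succAbove_iff, Fin.rev_lt_rev]
  constructor
  · intro H
    refine ⟨fun i h => ?_, ?_⟩
    · have := H i.succ (by simp; omega)
      have e : (⟨(i.succ : Fin (n+2)).val + 1, by simp; omega⟩ : Fin (n + 2)) =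
        Fin.succ ⟨i.val + 1, h⟩ := by ext; simp
      rw [e, keyS, keyS] at this
      simp only [Fin.val_succ] at this
      split_ifs at this ⊢ <;> omega
    · have := H 0 (by simp)
      simp only [Fin.val_zero, Nat.zero_mod, if_true] at this
      exact key0.1 this
  · rintro ⟨H, H0⟩ i
    refine Fin.cases ?_ (fun i => ?_) i
    · intro h
      simp only [Fin.val_zero, Nat.zero_mod, if_true]
      exact key0.2 H0
    · intro h
      have h' : i.val + 1 < n + 1 := by simp at h; omega
      have := H i h'
      have e : (⟨(i.succ : Fin (n+2)).val + 1, h⟩ : Fin (n + 2)) =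
        Fin.succ ⟨i.val + 1, h'⟩ := by ext; simp
      rw [e, keyS, keyS]
      simp only [Fin.val_succ]
      split_ifs at this ⊢ <;> omega

open Classical in
/-- Entringer-type numbers -/
noncomputable def WW (n k : ℕ) : ℕ :=
  (Finset.univ.filter (fun σ : Equiv.Perm (Fin (n + 1)) => UD (n + 1) σ ∧ (σ 0 : ℕ) = k)).card

open Classical in
theorem WW_succ (n k : ℕ) (hk : k < n + 2) : WW (n + 1) k =
    (Finset.univ.filter (fun ρ : Equiv.Perm (Fin (n + 1)) =>
      UD (n + 1) ρ ∧ (ρ 0 : ℕ) + k < n + 1)).card := by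
  symm
  apply Finset.card_bij (fun ρ _ => insG ⟨k, hk⟩ ρ)
  · intro ρ hρ
    simp only [Finset.mem_filter, Finset.mem_univ, true_and] at hρ ⊢
    exact ⟨(insG_UD ⟨k, hk⟩ ρ).2 hρ, by rw [insG_zero]⟩
  · intro a _ b _ h
    exact insG_inj _ h
  · intro σ hσ
    simp only [Finset.mem_filter, Finset.mem_univ, true_and] at hσ
    obtain ⟨ρ, hρ⟩ := insG_surj ⟨k, hk⟩ σ (by ext; exact hσ.2)
    refine ⟨ρ, ?_, hρ⟩
    simp only [Finset.mem_filter, Finset.mem_univ, true_and]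
    rw [← hρ] at hσ
    exact (insG_UD ⟨k, hk⟩ ρ).1 hσ.1

theorem WW_last (n : ℕ) : WW (n + 1) (n + 1) = 0 := by
  classical
  rw [WW_succ _ _ (by omega), Finset.card_eq_zero, Finset.filter_eq_empty_iff]
  intro ρ _ h
  omega

theorem WW_rec (n k : ℕ) (hk : k ≤ n) : WW (n + 1) k = WW (n + 1) (k + 1) + WW n (n - k) := by
  classical
  rw [WW_succ _ _ (by omega), WW_succ _ _ (by omega), WW, ← Finset.card_union_of_disjoint]
  · congr 1
    ext ρ
    simp only [Finset.mem_filter, Finset.mem_univ, true_and, Finset.mem_union, ← and_or_left]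
    apply and_congr_right
    intro _
    omega
  · rw [Finset.disjoint_left]
    intro ρ
    simp only [Finset.mem_filter, Finset.mem_univ, true_and]
    omega

theorem WW_zero : WW 0 0 = 1 := by
  classical
  rw [WW, Finset.filter_true_of_mem]
  · simp
  · intro σ _
    refine ⟨fun i h => ?_, by omega⟩
    omega

theorem updown_eq (n : ℕ) : updownCount (n + 1) = WW (n + 1) 0 := by
  classical
  rw [WW_succ _ _ (by omega), updownCount, Nat.card_eq_fintype_card, Fintype.card_subtype]
  congr 1
  ext ρ
  simp only [Finset.mem_filter, Finset.mem_univ, true_and]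
  exact ⟨fun h => ⟨h, by omega⟩, fun h => h.1⟩

theorem HasSum.congr_fun' {f g : ℕ → ℝ} {a : ℝ} (h : HasSum f a) (e : ∀ m, g m = f m) :
    HasSum g a := by
  rw [funext e]
  exact h

theorem HasSum.congr_both' {f g : ℕ → ℝ} {a b : ℝ} (h : HasSum f a) (e : b = a)
    (e' : ∀ m, g m = f m) : HasSum g b := by
  rw [funext e', e]
  exact h

/-- the weights -/
noncomputable def cc (m : ℕ) : ℝ := 2 * (-1 : ℝ) ^ m / (Real.pi * (2 * (m : ℝ) + 1))

/-- divided power -/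
noncomputable def ee (k : ℕ) (x : ℝ) : ℝ := x ^ k / (k.factorial : ℝ)

theorem ee_deriv_succ (k : ℕ) (x : ℝ) : HasDerivAt (ee (k + 1)) (ee k x) x := by
  have := (hasDerivAt_pow (k + 1) x).div_const ((k + 1).factorial : ℝ)
  refine this.congr_deriv ?_
  unfold ee
  rw [Nat.factorial_succ]
  have : (k.factorial : ℝ) ≠ 0 := by positivity
  have : (k + 1 : ℝ) ≠ 0 := by positivity
  push_cast
  field_simp

theorem ee_deriv_zero (x : ℝ) : HasDerivAt (ee 0) 0 x := by
  have : ee 0 = fun _ => 1 := by ext; simp [ee]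
  rw [this]
  exact hasDerivAt_const _ _

theorem ee_comp {k : ℕ} {x d : ℝ} (h : HasDerivAt (ee k) d (1 - x)) :
    HasDerivAt (fun y => ee k (1 - y)) (-d) x := by
  have := h.comp x ((hasDerivAt_id x).const_sub 1)
  simpa [Function.comp_def] using this

/-- Bernstein-type polynomials -/
noncomputable def BB (n : ℕ) (x : ℝ) : ℝ :=
  ∑ k ∈ Finset.range (n + 1), (WW n k : ℝ) * (ee k x * ee (n - k) (1 - x))

theorem BB_deriv (n : ℕ) (x : ℝ) : HasDerivAt (BB (n + 1)) (-BB n (1 - x)) x := by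
  have h1 : ∀ k, ∃ d, HasDerivAt (ee k) d x ∧ (k = 0 → d = 0) ∧ (∀ j, k = j + 1 → d = ee j x) := by
    intro k
    cases k with
    | zero => exact ⟨0, ee_deriv_zero x, by simp, by simp⟩
    | succ k => exact ⟨ee k x, ee_deriv_succ k x, by simp, by intro j hj; simp at hj; rw [hj]⟩
  have h2 : ∀ k, ∃ d, HasDerivAt (ee k) d (1 - x) ∧ (k = 0 → d = 0) ∧
      (∀ j, k = j + 1 → d = ee j (1 - x)) := by
    intro k
    cases k with
    | zero => exact ⟨0, ee_deriv_zero _, by simp, by simp⟩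
    | succ k => exact ⟨ee k _, ee_deriv_succ k _, by simp, by intro j hj; simp at hj; rw [hj]⟩
  choose d1 h1 h10 h1s using h1
  choose d2 h2 h20 h2s using h2
  have H : HasDerivAt (BB (n + 1)) (∑ k ∈ Finset.range (n + 1 + 1), (WW (n + 1) k : ℝ) *
      (d1 k * ee (n + 1 - k) (1 - x) + ee k x * (-d2 (n + 1 - k)))) x := by
    unfold BB
    apply HasDerivAt.fun_sum
    intro k _
    exact ((h1 k).mul (ee_comp (h2 _))).const_mul _
  refine H.congr_deriv ?_
  symm
  simp only [mul_add, Finset.sum_add_distrib]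
  rw [Finset.sum_range_succ', Finset.sum_range_succ (fun k => (WW (n + 1) k : ℝ) *
      (ee k x * (-d2 (n + 1 - k)))), h10 0 rfl, Nat.sub_self, h20 0 rfl]
  simp only [zero_mul, mul_zero, neg_zero, add_zero]
  rw [← Finset.sum_add_distrib, BB, ← Finset.sum_range_reflect, ← Finset.sum_neg_distrib]
  apply Finset.sum_congr rfl
  intro k hk
  have hk' : k ≤ n := by simpa [Nat.lt_succ_iff] using hk
  rw [h1s (k + 1) k rfl, h2s (n + 1 - k) (n - k) (by omega), WW_rec n k hk']
  rw [show n + 1 - 1 - k = n - k by omega, show n - (n - k) = k by omega,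
    show n + 1 - (k + 1) = n - k by omega, show 1 - (1 - x) = x by ring]
  push_cast
  ring

theorem BB_one (n : ℕ) : BB (n + 1) 1 = 0 := by
  unfold BB
  rw [Finset.sum_range_succ, WW_last]
  simp only [Nat.cast_zero, zero_mul, add_zero]
  apply Finset.sum_eq_zero
  intro k hk
  have hk' : k < n + 1 := by simpa using hk
  have : ee (n + 1 - k) (1 - 1) = 0 := by
    simp [ee]
    left; omega
  rw [this]; simp

theorem BB_cont (n : ℕ) : Continuous (BB n) := by
  unfold BB ee
  fun_prop

theorem BB_int (n : ℕ) (x : ℝ) : ∫ y in (0 : ℝ)..(1 - x), BB n y = BB (n + 1) x := by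
  have := intervalIntegral.integral_eq_sub_of_hasDerivAt (f := fun y => BB (n + 1) (1 - y))
    (f' := BB n) (a := 0) (b := 1 - x) (fun y _ => ?_) ((BB_cont n).intervalIntegrable _ _)
  · rw [this]
    simp [BB_one]
  · have h := (BB_deriv n (1 - y)).comp y ((hasDerivAt_id y).const_sub 1)
    simpa [Function.comp_def] using h

theorem BB_zero' (n : ℕ) : BB n 0 = (WW n 0 : ℝ) / n.factorial := by
  unfold BB
  rw [Finset.sum_range_succ']
  rw [Finset.sum_eq_zero]
  · simp [ee]; ring
  · intro k _
    simp [ee]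

theorem BB_1 (x : ℝ) : BB 1 x = 1 - x := by
  have h1 : WW 1 1 = 0 := WW_last 0
  have h0 : WW 1 0 = 1 := by rw [WW_rec 0 0 le_rfl, h1, WW_zero]
  simp [BB, Finset.sum_range_succ, h1, h0, ee]

theorem B2_eval (x : ℝ) : Polynomial.eval x (Polynomial.map (algebraMap ℚ ℝ)
    (Polynomial.bernoulli (2 * 1))) = x ^ 2 - x + 1 / 6 := by
  simp [Polynomial.bernoulli, Finset.sum_range_succ, bernoulli]
  ring

theorem cc_sq (m : ℕ) : cc m ^ 2 = 4 / Real.pi ^ 2 * (1 / ((2 * m + 1 : ℕ) : ℝ) ^ 2) := by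
  unfold cc
  rw [div_pow, mul_pow, ← pow_mul, mul_comm m 2, pow_mul]
  have := Real.pi_ne_zero
  have : (2 * (m : ℝ) + 1) ≠ 0 := by positivity
  push_cast
  field_simp
  norm_num

theorem base_sum (x : ℝ) (h0 : 0 ≤ x) (h1 : x ≤ 1) :
    HasSum (fun m : ℕ => cc m ^ 2 * Real.cos (Real.pi * (2 * (m : ℝ) + 1) / 2 * x))
      ((1 - x) / 2) := by
  have S1 := hasSum_one_div_nat_pow_mul_cos (k := 1) one_ne_zero (x := x / 4)
    ⟨by positivity, by linarith⟩
  have S2 := hasSum_one_div_nat_pow_mul_cos (k := 1) one_ne_zero (x := x / 2)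
    ⟨by positivity, by linarith⟩
  rw [B2_eval] at S1 S2
  set f : ℕ → ℝ := fun n : ℕ => 1 / (n : ℝ) ^ (2 * 1) * Real.cos (2 * Real.pi * n * (x / 4)) with hf
  have So : Summable (fun m : ℕ => f (2 * m + 1)) :=
    S1.summable.comp_injective (i := fun m : ℕ => 2 * m + 1) (by intro a b h; simpa using h)
  have Se : HasSum (fun m : ℕ => f (2 * m)) (1 / 4 * ((-1) ^ (1 + 1) * (2 * Real.pi) ^ (2 * 1) / 2 /
      ((2 * 1).factorial : ℝ) * ((x / 2) ^ 2 - x / 2 + 1 / 6))) := by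
    have := S2.mul_left (1 / 4)
    refine this.congr_fun' (fun m => ?_)
    simp only [hf]
    push_cast
    rw [show 2 * Real.pi * (2 * (m : ℝ)) * (x / 4) = 2 * Real.pi * m * (x / 2) by ring]
    rw [mul_pow, ← mul_assoc]
    congr 1
    rw [one_div_mul_one_div]
    norm_num
  have h := (Se.even_add_odd So.hasSum).unique S1
  have Hs := So.hasSum.mul_left (4 / Real.pi ^ 2)
  have e : 4 / Real.pi ^ 2 * ∑' m : ℕ, f (2 * m + 1) = (1 - x) / 2 := by
    rw [← eq_sub_iff_add_eq'] at h
    rw [h]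
    have := Real.pi_ne_zero
    simp
    field_simp
    ring
  rw [e] at Hs
  refine Hs.congr_fun' (fun m => ?_)
  simp only [hf]
  rw [cc_sq, mul_assoc]
  push_cast
  congr 3
  ring

theorem cc_summable_sq : Summable (fun m => cc m ^ 2) := by
  simpa using (base_sum 0 le_rfl zero_le_one).summable

theorem cc_abs_le (m : ℕ) : |cc m| ≤ 1 := by
  unfold cc
  rw [abs_div, abs_mul, abs_pow, abs_neg, abs_one, one_pow, abs_of_pos (by positivity :
    0 < Real.pi * (2 * (m : ℝ) + 1)), div_le_one (by positivity)]
  have := Real.pi_gt_three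
  have : (0 : ℝ) ≤ m := by positivity
  rw [abs_two]
  nlinarith

theorem cc_summable (n : ℕ) : Summable (fun m => |cc m| ^ (n + 2)) := by
  apply Summable.of_nonneg_of_le _ _ cc_summable_sq
  · intro m; positivity
  · intro m
    rw [← sq_abs]
    exact pow_le_pow_of_le_one (abs_nonneg _) (cc_abs_le m) (by omega)

theorem sin_om (m : ℕ) : Real.sin (Real.pi * (2 * (m : ℝ) + 1) / 2) = (-1) ^ m := by
  rw [show Real.pi * (2 * (m : ℝ) + 1) / 2 = Real.pi / 2 + m * Real.pi by ring,
    Real.sin_add_nat_mul_pi]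
  simp

theorem cos_om (m : ℕ) : Real.cos (Real.pi * (2 * (m : ℝ) + 1) / 2) = 0 := by
  rw [show Real.pi * (2 * (m : ℝ) + 1) / 2 = Real.pi / 2 + m * Real.pi by ring,
    Real.cos_add_nat_mul_pi]
  simp

theorem cc_eq (m : ℕ) : cc m = (-1) ^ m / (Real.pi * (2 * (m : ℝ) + 1) / 2) := by
  unfold cc
  have := Real.pi_ne_zero
  have : (2 * (m : ℝ) + 1) ≠ 0 := by positivity
  field_simp

theorem int_cos (m : ℕ) (x : ℝ) :
    ∫ y in (0 : ℝ)..(1 - x), Real.cos (Real.pi * (2 * (m : ℝ) + 1) / 2 * y) =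
      cc m * Real.cos (Real.pi * (2 * (m : ℝ) + 1) / 2 * x) := by
  have hw : Real.pi * (2 * (m : ℝ) + 1) / 2 ≠ 0 := by positivity
  rw [intervalIntegral.integral_comp_mul_left _ hw, integral_cos, cc_eq, mul_sub, mul_one,
    Real.sin_sub, sin_om, cos_om]
  simp
  field_simp

theorem BB_sum (n : ℕ) : ∀ x : ℝ, 0 ≤ x → x ≤ 1 →
    HasSum (fun m : ℕ => cc m ^ (n + 2) * Real.cos (Real.pi * (2 * (m : ℝ) + 1) / 2 * x))
      (BB (n + 1) x / 2) := by
  induction n with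
  | zero => intro x h0 h1; rw [BB_1]; exact base_sum x h0 h1
  | succ n ih =>
    intro x h0 h1
    have := intervalIntegral.hasSum_integral_of_dominated_convergence (a := 0) (b := 1 - x)
      (μ := MeasureTheory.volume)
      (F := fun m y => cc m ^ (n + 2) * Real.cos (Real.pi * (2 * (m : ℝ) + 1) / 2 * y))
      (f := fun y => BB (n + 1) y / 2)
      (fun m _ => |cc m| ^ (n + 2)) ?_ ?_ ?_ ?_ ?_
    · rw [intervalIntegral.integral_div, BB_int] at this
      refine this.congr_fun' (fun m => ?_)
      rw [intervalIntegral.integral_const_mul, int_cos]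
      ring
    · intro m
      apply Continuous.aestronglyMeasurable
      fun_prop
    · intro m
      refine Filter.Eventually.of_forall (fun y _ => ?_)
      rw [Real.norm_eq_abs, abs_mul, abs_pow]
      exact mul_le_of_le_one_right (by positivity) (Real.abs_cos_le_one _)
    · exact Filter.Eventually.of_forall (fun y _ => cc_summable n)
    · exact intervalIntegrable_const
    · refine Filter.Eventually.of_forall (fun y hy => ?_)
      rw [Set.uIoc_of_le (by linarith)] at hy
      exact ih y hy.1.le (by linarith [hy.2])

theorem Abar_sum (n : ℕ) : HasSum (fun m : ℕ => cc m ^ (n + 2)) (Abar (n + 1) / 2) := by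
  have := BB_sum n 0 le_rfl zero_le_one
  rw [BB_zero', ← updown_eq] at this
  simpa [Abar] using this

/-- closed form of the cosine moments -/
noncomputable def RR (a : ℕ) (c : ℝ) : ℝ :=
  (∑ i ∈ Finset.range (a / 2 + 1), (-1 : ℝ) ^ i * c ^ (2 * i + 1) / ((a - 2 * i).factorial : ℝ)) +
    if Odd a then (-1 : ℝ) ^ ((a + 1) / 2) * c ^ (a + 1) else 0

theorem RR_rec (a : ℕ) (c : ℝ) :
    RR (a + 2) c = c / ((a + 2).factorial : ℝ) - c ^ 2 * RR a c := by
  unfold RR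
  rw [show (a + 2) / 2 + 1 = (a / 2 + 1) + 1 by omega, Finset.sum_range_succ', mul_add,
    Finset.mul_sum]
  have h1 : ∀ i, (-1 : ℝ) ^ (i + 1) * c ^ (2 * (i + 1) + 1) / ((a + 2 - 2 * (i + 1)).factorial : ℝ)
      = -(c ^ 2 * ((-1 : ℝ) ^ i * c ^ (2 * i + 1) / ((a - 2 * i).factorial : ℝ))) := by
    intro i
    rw [show a + 2 - 2 * (i + 1) = a - 2 * i by omega]
    ring
  simp only [h1, Finset.sum_neg_distrib]
  have h2 : Odd (a + 2) ↔ Odd a := by simp [Nat.odd_add, parity_simps]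
  simp only [h2]
  rw [show (a + 2 + 1) / 2 = (a + 1) / 2 + 1 by omega]
  split_ifs
  · simp
    ring
  · simp
    ring

/-- cosine moments -/
noncomputable def JJ (a m : ℕ) : ℝ :=
  ∫ x in (0 : ℝ)..1, ee a x * Real.cos (Real.pi * (2 * (m : ℝ) + 1) / 2 * x)

theorem Icoef_eq (a m : ℕ) : Icoef a (m + 1) = JJ a m := by
  unfold Icoef JJ ee
  rw [← intervalIntegral.integral_const_mul]
  apply intervalIntegral.integral_congr
  intro x _
  simp only
  push_cast
  rw [show Real.pi * (2 * ((m : ℝ) + 1) - 1) * x / 2 = Real.pi * (2 * (m : ℝ) + 1) / 2 * x by ring]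
  ring

theorem ee_cont (a : ℕ) : Continuous (ee a) := by
  unfold ee
  fun_prop

theorem sin_deriv (w x : ℝ) : HasDerivAt (fun x => Real.sin (w * x)) (Real.cos (w * x) * w) x := by
  have := ((hasDerivAt_id x).const_mul w).sin
  simpa using this

theorem cos_deriv (w x : ℝ) : HasDerivAt (fun x => Real.cos (w * x)) (-Real.sin (w * x) * w) x := by
  have := ((hasDerivAt_id x).const_mul w).cos
  simpa using this

theorem JJ_gen (a m : ℕ) (d : ℝ → ℝ) (hd : Continuous d) (h : ∀ x, HasDerivAt (ee a) (d x) x) :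
    JJ (a + 1) m + cc m ^ 2 * (∫ x in (0 : ℝ)..1, d x * Real.cos (Real.pi * (2 * (m : ℝ) + 1) / 2 * x))
     = cc m / ((a + 1).factorial : ℝ) - cc m ^ 2 * ee a 0 := by
  have hw : Real.pi * (2 * (m : ℝ) + 1) / 2 ≠ 0 := by positivity
  have hc := cc_eq m
  have hs := sin_om m
  have hco := cos_om m
  unfold JJ
  set w := Real.pi * (2 * (m : ℝ) + 1) / 2 with hwd
  have hc2 : cc m ^ 2 = 1 / w ^ 2 := by
    rw [hc, div_pow, ← pow_mul, mul_comm m 2, pow_mul]; norm_num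
  have he := ee_cont (a + 1)
  rw [← intervalIntegral.integral_const_mul, ← intervalIntegral.integral_add
    (Continuous.intervalIntegrable (by fun_prop) _ _) (Continuous.intervalIntegrable (by fun_prop) _ _)]
  rw [intervalIntegral.integral_eq_sub_of_hasDerivAt
    (f := fun x => ee (a + 1) x * Real.sin (w * x) / w + ee a x * Real.cos (w * x) / w ^ 2)]
  · rw [mul_one, hs, hco, hc2, hc]
    simp [ee]
    ring
  · intro x _
    refine ((((ee_deriv_succ a x).mul (sin_deriv w x)).div_const w).add
      (((h x).mul (cos_deriv w x)).div_const (w ^ 2))).congr_deriv ?_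
    rw [hc2]
    field_simp
    ring
  · exact Continuous.intervalIntegrable (by fun_prop) _ _

theorem JJ_eq (a m : ℕ) : JJ a m = RR a (cc m) := by
  induction a using Nat.strong_induction_on with
  | _ a ih =>
    match a, ih with
    | 0, _ =>
      have := int_cos m 0
      simp [JJ, RR, ee] at this ⊢
      exact this
    | 1, _ =>
      have := JJ_gen 0 m (fun _ => 0) continuous_const ee_deriv_zero
      simp [ee] at this
      rw [this]
      simp [RR]
      ring
    | a + 2, ih =>
      have := JJ_gen (a + 1) m (ee a) (ee_cont a) (ee_deriv_succ a)
      rw [RR_rec, ← ih a (by omega), JJ.eq_1 a, eq_sub_iff_add_eq, this]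
      simp [ee]

theorem main_sum (N p q : ℕ) :
    HasSum (fun m => cc m ^ N * RR p (cc m) * RR q (cc m)) (XN N p q / 2) := by
  have H1 : HasSum (fun m => ∑ i ∈ Finset.range (p / 2 + 1), ∑ j ∈ Finset.range (q / 2 + 1),
      (-1 : ℝ) ^ (i + j) / (((p - 2 * i).factorial : ℝ) * ((q - 2 * j).factorial : ℝ)) *
        cc m ^ (N + 2 * i + 2 * j + 2)) _ :=
    hasSum_sum (fun i _ => hasSum_sum (fun j _ => (Abar_sum (N + 2 * i + 2 * j)).mul_left _))
  have H2 : HasSum (fun m => ∑ j ∈ Finset.range (q / 2 + 1),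
      (-1 : ℝ) ^ ((p + 1) / 2) * (-1 : ℝ) ^ j / ((q - 2 * j).factorial : ℝ) *
        cc m ^ (N + p + 2 * j + 2)) _ :=
    hasSum_sum (fun j _ => (Abar_sum (N + p + 2 * j)).mul_left _)
  have H3 : HasSum (fun m => ∑ i ∈ Finset.range (p / 2 + 1),
      (-1 : ℝ) ^ ((q + 1) / 2) * (-1 : ℝ) ^ i / ((p - 2 * i).factorial : ℝ) *
        cc m ^ (N + q + 2 * i + 2)) _ :=
    hasSum_sum (fun j _ => (Abar_sum (N + q + 2 * j)).mul_left _)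
  have H4 := (Abar_sum (N + p + q)).mul_left ((-1 : ℝ) ^ ((p + q) / 2 + 1))
  have H2' := H2.mul_left (if Odd p then (1 : ℝ) else 0)
  have H3' := H3.mul_left (if Odd q then (1 : ℝ) else 0)
  have H4' := H4.mul_left (if Odd p ∧ Odd q then (1 : ℝ) else 0)
  have H := ((H1.add H2').add H3').add H4'
  refine H.congr_both' ?_ ?_
  · unfold XN
    rw [add_div, add_div, add_div]
    congr 1
    · congr 1
      · congr 1
        · simp only [Finset.sum_div]
          refine Finset.sum_congr rfl (fun i _ => Finset.sum_congr rfl (fun j _ => ?_))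
          ring
        · split_ifs
          · rw [one_mul, Finset.mul_sum, Finset.sum_div]
            refine Finset.sum_congr rfl (fun j _ => ?_)
            ring
          · simp
      · split_ifs
        · rw [one_mul, Finset.mul_sum, Finset.sum_div]
          refine Finset.sum_congr rfl (fun j _ => ?_)
          ring
        · simp
    · split_ifs
      · ring
      · simp
  · intro m
    generalize cc m = c
    unfold RR
    rw [mul_assoc, add_mul, mul_add, mul_add, Finset.sum_mul_sum, mul_add, mul_add, mul_add,
      ← add_assoc, Finset.mul_sum]
    congr 1
    · rw [add_assoc, add_assoc]
      congr 1
      · refine Finset.sum_congr rfl (fun i _ => ?_)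
        rw [Finset.mul_sum]
        refine Finset.sum_congr rfl (fun j _ => ?_)
        field_simp
        ring
      · rw [add_comm]
        congr 1
        · split_ifs
          · rw [Finset.mul_sum, Finset.mul_sum, Finset.mul_sum]
            refine Finset.sum_congr rfl (fun j _ => ?_)
            field_simp
            ring
          · simp
        · split_ifs
          · rw [Finset.sum_mul, Finset.mul_sum, Finset.mul_sum]
            refine Finset.sum_congr rfl (fun j _ => ?_)
            field_simp
            ring
          · simp
    · by_cases hp : Odd p <;> by_cases hq : Odd q <;> simp [hp, hq]
      obtain ⟨a, rfl⟩ := hp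
      obtain ⟨b, rfl⟩ := hq
      rw [show (2 * a + 1 + 1) / 2 = a + 1 by omega, show (2 * b + 1 + 1) / 2 = b + 1 by omega,
        show (2 * a + 1 + (2 * b + 1)) / 2 + 1 = a + 1 + (b + 1) by omega]
      ring

/-- **Series representation of `X_N(p,q)`**:
`X_N(p,q) = 2 Σ_{j≥1} (2(−1)^{j+1}/(π(2j−1)))^N I(p,j) I(q,j)`
(the series, reindexed by `j ← m+1`, converges). -/
theorem XN_series (N p q : ℕ) (hN : 1 ≤ N) :
    Summable (fun m : ℕ =>
      (2 * (-1 : ℝ) ^ m / (Real.pi * (2 * (m : ℝ) + 1))) ^ N *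
        Icoef p (m + 1) * Icoef q (m + 1)) ∧
    XN N p q =
      2 * ∑' m : ℕ,
        (2 * (-1 : ℝ) ^ m / (Real.pi * (2 * (m : ℝ) + 1))) ^ N *
          Icoef p (m + 1) * Icoef q (m + 1) := by
  have h := main_sum N p q
  have h' : HasSum (fun m : ℕ =>
      (2 * (-1 : ℝ) ^ m / (Real.pi * (2 * (m : ℝ) + 1))) ^ N *
        Icoef p (m + 1) * Icoef q (m + 1)) (XN N p q / 2) := by
    refine h.congr_fun' (fun m => ?_)
    rw [Icoef_eq, Icoef_eq, JJ_eq, JJ_eq, cc]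
  refine ⟨h'.summable, ?_⟩
  rw [h'.tsum_eq]
  ring
end
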